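/- Suppose f is a continuous periodic map of the plane that is linear with integer coefficients on each of the half planes x ≥ 0 and x < 0. Then the period of f is 1, 2, 3, 4, 5, 6, 7, 8, 9 or 12. -/

import Mathlib

set_option linter.unusedTactic false
set_option linter.unreachableTactic false


/-- `x` satisfies the second order piecewise linear recurrence. -/
def PRec (p q e : ℤ) (x : ℕ → ℝ) : Prop :=
  ∀ i, (0 ≤ x (i+1) → x (i+2) = p * x (i+1) - e * x i) ∧
    (x (i+1) ≤ 0 → x (i+2) = q * x (i+1) - e * x i)

def PAll (p q e : ℤ) (n : ℕ) : Prop := ∀ x, PRec p q e x → ∀ i, x (i+n) = x i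

def PGood (p q e : ℤ) (k : ℕ) : Prop := ∀ x, PRec p q e x → x k = x 0 ∧ x (k+1) = x 1

lemma PRec.neg {p q e : ℤ} {x : ℕ → ℝ} (h : PRec p q e x) : PRec q p e (fun i => - x i) := by
  intro i
  obtain ⟨h1, h2⟩ := h i
  constructor
  · intro h; have := h2 (by simpa using h); simp only [this]; ring
  · intro h; have := h1 (by simpa using h); simp only [this]; ring

lemma PAll.swap {p q e : ℤ} {n : ℕ} (h : PAll p q e n) : PAll q p e n := by
  intro x hx i
  simpa using h _ hx.neg i

lemma PGood.swap {p q e : ℤ} {n : ℕ} (h : PGood p q e n) : PGood q p e n := by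
  intro x hx
  simpa using h _ hx.neg

lemma PRec.exists (p q e : ℤ) (u v : ℝ) : ∃ x, PRec p q e x ∧ x 0 = u ∧ x 1 = v := by
  let s : ℕ → ℝ × ℝ := fun n => Nat.rec (u, v)
    (fun _ w => (w.2, (if 0 ≤ w.2 then (p:ℝ) else q) * w.2 - e * w.1)) n
  have hs : ∀ n, s (n+1) = ((s n).2, (if 0 ≤ (s n).2 then (p:ℝ) else q) * (s n).2 - e * (s n).1) :=
    fun n => rfl
  refine ⟨fun n => (s n).1, ?_, rfl, rfl⟩
  intro i
  have h1 : (s (i+1)).1 = (s i).2 := by rw [hs]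
  have h2 : (s (i+2)).1 = (if 0 ≤ (s i).2 then (p:ℝ) else q) * (s i).2 - e * (s i).1 := by
    rw [hs (i+1), hs i]
  simp only [h1, h2]
  constructor
  · intro h; simp [h]
  · intro h
    rcases h.lt_or_eq with h | h
    · simp [not_le.2 h]
    · simp [h]

/-- growth principle -/
lemma no_growth {p q e : ℤ} {n m : ℕ} (hn : 1 ≤ n) (h : PAll p q e n) (u v : ℝ)
    (I : ℝ → ℝ → Prop) (h0 : I u v)
    (hI : ∀ x, PRec p q e x → ∀ i, I (x i) (x (i+1)) →
      I (x (i+m)) (x (i+m+1)) ∧ |x (i+1)| < |x (i+m+1)|) : False := by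
  obtain ⟨x, hx, hu, hv⟩ := PRec.exists p q e u v
  have key : ∀ k, I (x (m*k)) (x (m*k+1)) := by
    intro k
    induction k with
    | zero => simpa [hu, hv] using h0
    | succ k ih => exact (hI x hx _ ih).1
  have mono : StrictMono (fun k => |x (m*k+1)|) := strictMono_nat_of_lt_succ fun k => by
    have := (hI x hx _ (key k)).2
    simpa [mul_add] using this
  have h1 := mono (show 0 < n by omega)
  have h2 : ∀ k, x (n*k+1) = x 1 := by
    intro k
    induction k with
    | zero => simp
    | succ k ih => rw [← ih, ← h x hx (n*k+1)]; congr 1; ring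
  simp only [mul_zero, zero_add] at h1
  rw [mul_comm, h2] at h1
  exact lt_irrefl _ h1

lemma neg_e {p q : ℤ} {n : ℕ} (hn : 1 ≤ n) (h : PAll p q (-1) n) (hp : 1 ≤ p) : False := by
  have hp' : (1:ℝ) ≤ p := by exact_mod_cast hp
  refine no_growth (m := 1) hn h 1 1 (fun a b => 0 < a ∧ 0 < b) (by norm_num) ?_
  rintro x hx i ⟨h1, h2⟩
  have := (hx i).1 h2.le
  push_cast at this
  have h3 : x (i+1) < x (i+1+1) := by rw [this]; nlinarith
  exact ⟨⟨h2, h2.trans h3⟩, by rw [abs_of_pos h2, abs_of_pos (h2.trans h3)]; exact h3⟩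

lemma neg_e' {p q : ℤ} {n : ℕ} (hn : 1 ≤ n) (h : PAll p q (-1) n) (hp : p ≤ -1) (hq : q ≤ 0) :
    False := by
  have hp' : (p:ℝ) ≤ -1 := by exact_mod_cast hp
  have hq' : (q:ℝ) ≤ 0 := by exact_mod_cast hq
  refine no_growth (m := 2) hn h 1 (-1) (fun a b => 0 < a ∧ b < 0) (by norm_num) ?_
  rintro x hx i ⟨h1, h2⟩
  have e1 := (hx i).2 h2.le
  have h3 : 0 < x (i+2) := by rw [e1]; push_cast; nlinarith
  have e2 := (hx (i+1)).1 h3.le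
  have h4 : x (i+2+1) < x (i+1) := by rw [e2]; push_cast; nlinarith
  refine ⟨⟨h3, h4.trans h2⟩, ?_⟩
  rw [abs_of_neg h2, abs_of_neg (h4.trans h2)]; linarith

lemma neg_e_zero {p q : ℤ} {n : ℕ} (hn : 1 ≤ n) (h : PAll p q (-1) n) : p = 0 ∧ q = 0 := by
  have a1 : ¬ 1 ≤ p := neg_e hn h
  have a2 : ¬ 1 ≤ q := neg_e hn h.swap
  have a3 : ¬ p ≤ -1 := fun hp => neg_e' hn h hp (by omega)
  have a4 : ¬ q ≤ -1 := fun hp => neg_e' hn h.swap hp (by omega)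
  omega

lemma pos_two {p q : ℤ} {n : ℕ} (hn : 1 ≤ n) (h : PAll p q 1 n) (hp : 2 ≤ p) : False := by
  have hp' : (2:ℝ) ≤ p := by exact_mod_cast hp
  refine no_growth (m := 1) hn h 0 1 (fun a b => 0 ≤ a ∧ a < b) (by norm_num) ?_
  rintro x hx i ⟨h1, h2⟩
  have h0 : 0 < x (i+1) := h1.trans_lt h2
  have := (hx i).1 h0.le
  have h3 : x (i+1) < x (i+1+1) := by rw [this]; push_cast; nlinarith
  exact ⟨⟨h0.le, h3⟩, by rw [abs_of_pos h0, abs_of_pos (h0.trans h3)]; exact h3⟩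

lemma pos_one {q : ℤ} {n : ℕ} (hn : 1 ≤ n) (h : PAll 1 q 1 n) (hq : q ≤ -2) : False := by
  have hq' : (q:ℝ) ≤ -2 := by exact_mod_cast hq
  refine no_growth (m := 4) hn h 0 (-1) (fun a b => 0 ≤ a ∧ a < -b) (by norm_num) ?_
  rintro x hx i ⟨h1, h2⟩
  have h0 : x (i+1) < 0 := by linarith
  have e1 := (hx i).2 h0.le
  have h3 : - x (i+1) < x (i+2) := by rw [e1]; push_cast; nlinarith
  have e2 := (hx (i+1)).1 (by linarith : 0 ≤ x (i+2))
  push_cast at e2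
  have e3 := (hx (i+2)).1 (by linarith : 0 ≤ x (i+3))
  push_cast at e3
  have e4 := (hx (i+3)).1 (by linarith : 0 ≤ x (i+4))
  push_cast at e4
  have h5 : x (i+4+1) < x (i+1) := by linarith
  refine ⟨⟨by linarith, by linarith⟩, ?_⟩
  rw [abs_of_neg h0, abs_of_neg (by linarith)]; linarith

lemma pos_zero {q : ℤ} {n : ℕ} (hn : 1 ≤ n) (h : PAll 0 q 1 n) (hq : q ≤ -2) : False := by
  have hq' : (q:ℝ) ≤ -2 := by exact_mod_cast hq
  refine no_growth (m := 3) hn h 0 (-1) (fun a b => 0 ≤ a ∧ a < -b) (by norm_num) ?_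
  rintro x hx i ⟨h1, h2⟩
  have h0 : x (i+1) < 0 := by linarith
  have e1 := (hx i).2 h0.le
  have h3 : - x (i+1) < x (i+2) := by rw [e1]; push_cast; nlinarith
  have e2 := (hx (i+1)).1 (by linarith : 0 ≤ x (i+2))
  push_cast at e2
  have e3 := (hx (i+2)).1 (by linarith : 0 ≤ x (i+3))
  push_cast at e3
  have h5 : x (i+3+1) < x (i+1) := by linarith
  refine ⟨⟨by linarith, by linarith⟩, ?_⟩
  rw [abs_of_neg h0, abs_of_neg (by linarith)]; linarith

lemma pos_neg_one {q : ℤ} {n : ℕ} (hn : 1 ≤ n) (h : PAll (-1) q 1 n) (hq : q ≤ -4) : False := by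
  have hq' : (q:ℝ) ≤ -4 := by exact_mod_cast hq
  refine no_growth (m := 2) hn h 0 (-1) (fun a b => a < - 2 * b ∧ b < 0) (by norm_num) ?_
  rintro x hx i ⟨h1, h0⟩
  have e1 := (hx i).2 h0.le
  have h3 : -4 * x (i+1) - x i ≤ x (i+2) := by rw [e1]; push_cast; nlinarith
  have e2 := (hx (i+1)).1 (by linarith : 0 ≤ x (i+2))
  push_cast at e2
  have h5 : x (i+2+1) < x (i+1) := by linarith
  refine ⟨⟨by linarith, by linarith⟩, ?_⟩
  rw [abs_of_neg h0, abs_of_neg (by linarith)]; linarith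

lemma pos_neg_two {p q : ℤ} {n : ℕ} (hn : 1 ≤ n) (h : PAll p q 1 n) (hp : p ≤ -2)
    (hq : q ≤ -2) : False := by
  have hq' : (q:ℝ) ≤ -2 := by exact_mod_cast hq
  have hp' : (p:ℝ) ≤ -2 := by exact_mod_cast hp
  refine no_growth (m := 2) hn h 0 (-1) (fun a b => 0 ≤ a ∧ a < -b) (by norm_num) ?_
  rintro x hx i ⟨h1, h2⟩
  have h0 : x (i+1) < 0 := by linarith
  have e1 := (hx i).2 h0.le
  have h3 : - x (i+1) < x (i+2) := by rw [e1]; push_cast; nlinarith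
  have e2 := (hx (i+1)).1 (by linarith : 0 ≤ x (i+2))
  have h4 : x (i+2+1) < - x (i+2) := by rw [e2]; push_cast; nlinarith
  refine ⟨⟨by linarith, by linarith⟩, ?_⟩
  rw [abs_of_neg h0, abs_of_neg (by linarith)]; linarith

/-- one step of the recurrence, with a strict sign alternative -/
lemma PRec.step {p q : ℤ} {x : ℕ → ℝ} (h : PRec p q 1 x) (i : ℕ) :
    (0 ≤ x (i+1) ∧ x (i+2) = p * x (i+1) - x i) ∨ (x (i+1) < 0 ∧ x (i+2) = q * x (i+1) - x i) := by
  rcases le_or_gt 0 (x (i+1)) with g | g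
  · left; exact ⟨g, by simpa using (h i).1 g⟩
  · right; exact ⟨g, by simpa using (h i).2 g.le⟩

lemma good_6 : PGood (1) (1) 1 6 := by
  intro x hx
  rcases hx.step 0 with ⟨g0, e0⟩ | ⟨g0, e0⟩ <;> norm_num at g0 e0
  all_goals (
    rcases hx.step 1 with ⟨g1, e1⟩ | ⟨g1, e1⟩ <;> norm_num at g1 e1 <;> rw [e0] at g1 <;>
    (try simp only [e0] at e1) <;> (try ring_nf at e1) <;> try (exfalso; linarith only [g0, g1]))
  all_goals (
    rcases hx.step 2 with ⟨g2, e2⟩ | ⟨g2, e2⟩ <;> norm_num at g2 e2 <;> rw [e1] at g2 <;>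
    (try simp only [e1, e0] at e2) <;> (try ring_nf at e2) <;> try (exfalso; linarith only [g0, g1, g2]))
  all_goals (
    rcases hx.step 3 with ⟨g3, e3⟩ | ⟨g3, e3⟩ <;> norm_num at g3 e3 <;> rw [e2] at g3 <;>
    (try simp only [e2, e1] at e3) <;> (try ring_nf at e3) <;> try (exfalso; linarith only [g0, g1, g2, g3]))
  all_goals (
    rcases hx.step 4 with ⟨g4, e4⟩ | ⟨g4, e4⟩ <;> norm_num at g4 e4 <;> rw [e3] at g4 <;>
    (try simp only [e3, e2] at e4) <;> (try ring_nf at e4) <;> try (exfalso; linarith only [g0, g1, g2, g3, g4]))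
  all_goals (
    rcases hx.step 5 with ⟨g5, e5⟩ | ⟨g5, e5⟩ <;> norm_num at g5 e5 <;> rw [e4] at g5 <;>
    (try simp only [e4, e3] at e5) <;> (try ring_nf at e5) <;> try (exfalso; linarith only [g0, g1, g2, g3, g4, g5]))
  all_goals
    refine ⟨?_, show x 7 = x 1 from ?_⟩
    · first | exact e4 | linarith
    · first | exact e5 | linarith

lemma good_5 : PGood (1) (0) 1 5 := by
  intro x hx
  rcases hx.step 0 with ⟨g0, e0⟩ | ⟨g0, e0⟩ <;> norm_num at g0 e0
  all_goals (
    rcases hx.step 1 with ⟨g1, e1⟩ | ⟨g1, e1⟩ <;> norm_num at g1 e1 <;> rw [e0] at g1 <;>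
    (try simp only [e0] at e1) <;> (try ring_nf at e1) <;> try (exfalso; linarith only [g0, g1]))
  all_goals (
    rcases hx.step 2 with ⟨g2, e2⟩ | ⟨g2, e2⟩ <;> norm_num at g2 e2 <;> rw [e1] at g2 <;>
    (try simp only [e1, e0] at e2) <;> (try ring_nf at e2) <;> try (exfalso; linarith only [g0, g1, g2]))
  all_goals (
    rcases hx.step 3 with ⟨g3, e3⟩ | ⟨g3, e3⟩ <;> norm_num at g3 e3 <;> rw [e2] at g3 <;>
    (try simp only [e2, e1] at e3) <;> (try ring_nf at e3) <;> try (exfalso; linarith only [g0, g1, g2, g3]))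
  all_goals (
    rcases hx.step 4 with ⟨g4, e4⟩ | ⟨g4, e4⟩ <;> norm_num at g4 e4 <;> rw [e3] at g4 <;>
    (try simp only [e3, e2] at e4) <;> (try ring_nf at e4) <;> try (exfalso; linarith only [g0, g1, g2, g3, g4]))
  all_goals
    refine ⟨?_, show x 6 = x 1 from ?_⟩
    · first | exact e3 | linarith
    · first | exact e4 | linarith

lemma good_9 : PGood (1) (-1) 1 9 := by
  intro x hx
  rcases hx.step 0 with ⟨g0, e0⟩ | ⟨g0, e0⟩ <;> norm_num at g0 e0
  all_goals (
    rcases hx.step 1 with ⟨g1, e1⟩ | ⟨g1, e1⟩ <;> norm_num at g1 e1 <;> rw [e0] at g1 <;>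
    (try simp only [e0] at e1) <;> (try ring_nf at e1) <;> try (exfalso; linarith only [g0, g1]))
  all_goals (
    rcases hx.step 2 with ⟨g2, e2⟩ | ⟨g2, e2⟩ <;> norm_num at g2 e2 <;> rw [e1] at g2 <;>
    (try simp only [e1, e0] at e2) <;> (try ring_nf at e2) <;> try (exfalso; linarith only [g0, g1, g2]))
  all_goals (
    rcases hx.step 3 with ⟨g3, e3⟩ | ⟨g3, e3⟩ <;> norm_num at g3 e3 <;> rw [e2] at g3 <;>
    (try simp only [e2, e1] at e3) <;> (try ring_nf at e3) <;> try (exfalso; linarith only [g0, g1, g2, g3]))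
  all_goals (
    rcases hx.step 4 with ⟨g4, e4⟩ | ⟨g4, e4⟩ <;> norm_num at g4 e4 <;> rw [e3] at g4 <;>
    (try simp only [e3, e2] at e4) <;> (try ring_nf at e4) <;> try (exfalso; linarith only [g0, g1, g2, g3, g4]))
  all_goals (
    rcases hx.step 5 with ⟨g5, e5⟩ | ⟨g5, e5⟩ <;> norm_num at g5 e5 <;> rw [e4] at g5 <;>
    (try simp only [e4, e3] at e5) <;> (try ring_nf at e5) <;> try (exfalso; linarith only [g0, g1, g2, g3, g4, g5]))
  all_goals (
    rcases hx.step 6 with ⟨g6, e6⟩ | ⟨g6, e6⟩ <;> norm_num at g6 e6 <;> rw [e5] at g6 <;>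
    (try simp only [e5, e4] at e6) <;> (try ring_nf at e6) <;> try (exfalso; linarith only [g0, g1, g2, g3, g4, g5, g6]))
  all_goals (
    rcases hx.step 7 with ⟨g7, e7⟩ | ⟨g7, e7⟩ <;> norm_num at g7 e7 <;> rw [e6] at g7 <;>
    (try simp only [e6, e5] at e7) <;> (try ring_nf at e7) <;> try (exfalso; linarith only [g0, g1, g2, g3, g4, g5, g6, g7]))
  all_goals (
    rcases hx.step 8 with ⟨g8, e8⟩ | ⟨g8, e8⟩ <;> norm_num at g8 e8 <;> rw [e7] at g8 <;>
    (try simp only [e7, e6] at e8) <;> (try ring_nf at e8) <;> try (exfalso; linarith only [g0, g1, g2, g3, g4, g5, g6, g7, g8]))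
  all_goals
    refine ⟨?_, show x 10 = x 1 from ?_⟩
    · first | exact e7 | linarith
    · first | exact e8 | linarith

lemma good_4 : PGood (0) (0) 1 4 := by
  intro x hx
  rcases hx.step 0 with ⟨g0, e0⟩ | ⟨g0, e0⟩ <;> norm_num at g0 e0
  all_goals (
    rcases hx.step 1 with ⟨g1, e1⟩ | ⟨g1, e1⟩ <;> norm_num at g1 e1 <;> rw [e0] at g1 <;>
    (try simp only [e0] at e1) <;> (try ring_nf at e1) <;> try (exfalso; linarith only [g0, g1]))
  all_goals (
    rcases hx.step 2 with ⟨g2, e2⟩ | ⟨g2, e2⟩ <;> norm_num at g2 e2 <;> rw [e1] at g2 <;>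
    (try simp only [e1, e0] at e2) <;> (try ring_nf at e2) <;> try (exfalso; linarith only [g0, g1, g2]))
  all_goals (
    rcases hx.step 3 with ⟨g3, e3⟩ | ⟨g3, e3⟩ <;> norm_num at g3 e3 <;> rw [e2] at g3 <;>
    (try simp only [e2, e1] at e3) <;> (try ring_nf at e3) <;> try (exfalso; linarith only [g0, g1, g2, g3]))
  all_goals
    refine ⟨?_, show x 5 = x 1 from ?_⟩
    · first | exact e2 | linarith
    · first | exact e3 | linarith

lemma good_7 : PGood (0) (-1) 1 7 := by
  intro x hx
  rcases hx.step 0 with ⟨g0, e0⟩ | ⟨g0, e0⟩ <;> norm_num at g0 e0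
  all_goals (
    rcases hx.step 1 with ⟨g1, e1⟩ | ⟨g1, e1⟩ <;> norm_num at g1 e1 <;> rw [e0] at g1 <;>
    (try simp only [e0] at e1) <;> (try ring_nf at e1) <;> try (exfalso; linarith only [g0, g1]))
  all_goals (
    rcases hx.step 2 with ⟨g2, e2⟩ | ⟨g2, e2⟩ <;> norm_num at g2 e2 <;> rw [e1] at g2 <;>
    (try simp only [e1, e0] at e2) <;> (try ring_nf at e2) <;> try (exfalso; linarith only [g0, g1, g2]))
  all_goals (
    rcases hx.step 3 with ⟨g3, e3⟩ | ⟨g3, e3⟩ <;> norm_num at g3 e3 <;> rw [e2] at g3 <;>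
    (try simp only [e2, e1] at e3) <;> (try ring_nf at e3) <;> try (exfalso; linarith only [g0, g1, g2, g3]))
  all_goals (
    rcases hx.step 4 with ⟨g4, e4⟩ | ⟨g4, e4⟩ <;> norm_num at g4 e4 <;> rw [e3] at g4 <;>
    (try simp only [e3, e2] at e4) <;> (try ring_nf at e4) <;> try (exfalso; linarith only [g0, g1, g2, g3, g4]))
  all_goals (
    rcases hx.step 5 with ⟨g5, e5⟩ | ⟨g5, e5⟩ <;> norm_num at g5 e5 <;> rw [e4] at g5 <;>
    (try simp only [e4, e3] at e5) <;> (try ring_nf at e5) <;> try (exfalso; linarith only [g0, g1, g2, g3, g4, g5]))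
  all_goals (
    rcases hx.step 6 with ⟨g6, e6⟩ | ⟨g6, e6⟩ <;> norm_num at g6 e6 <;> rw [e5] at g6 <;>
    (try simp only [e5, e4] at e6) <;> (try ring_nf at e6) <;> try (exfalso; linarith only [g0, g1, g2, g3, g4, g5, g6]))
  all_goals
    refine ⟨?_, show x 8 = x 1 from ?_⟩
    · first | exact e5 | linarith
    · first | exact e6 | linarith

lemma good_3 : PGood (-1) (-1) 1 3 := by
  intro x hx
  rcases hx.step 0 with ⟨g0, e0⟩ | ⟨g0, e0⟩ <;> norm_num at g0 e0
  all_goals (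
    rcases hx.step 1 with ⟨g1, e1⟩ | ⟨g1, e1⟩ <;> norm_num at g1 e1 <;> rw [e0] at g1 <;>
    (try simp only [e0] at e1) <;> (try ring_nf at e1) <;> try (exfalso; linarith only [g0, g1]))
  all_goals (
    rcases hx.step 2 with ⟨g2, e2⟩ | ⟨g2, e2⟩ <;> norm_num at g2 e2 <;> rw [e1] at g2 <;>
    (try simp only [e1, e0] at e2) <;> (try ring_nf at e2) <;> try (exfalso; linarith only [g0, g1, g2]))
  all_goals
    refine ⟨?_, show x 4 = x 1 from ?_⟩
    · first | exact e1 | linarith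
    · first | exact e2 | linarith

lemma good_8 : PGood (-1) (-2) 1 8 := by
  intro x hx
  rcases hx.step 0 with ⟨g0, e0⟩ | ⟨g0, e0⟩ <;> norm_num at g0 e0
  all_goals (
    rcases hx.step 1 with ⟨g1, e1⟩ | ⟨g1, e1⟩ <;> norm_num at g1 e1 <;> rw [e0] at g1 <;>
    (try simp only [e0] at e1) <;> (try ring_nf at e1) <;> try (exfalso; linarith only [g0, g1]))
  all_goals (
    rcases hx.step 2 with ⟨g2, e2⟩ | ⟨g2, e2⟩ <;> norm_num at g2 e2 <;> rw [e1] at g2 <;>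
    (try simp only [e1, e0] at e2) <;> (try ring_nf at e2) <;> try (exfalso; linarith only [g0, g1, g2]))
  all_goals (
    rcases hx.step 3 with ⟨g3, e3⟩ | ⟨g3, e3⟩ <;> norm_num at g3 e3 <;> rw [e2] at g3 <;>
    (try simp only [e2, e1] at e3) <;> (try ring_nf at e3) <;> try (exfalso; linarith only [g0, g1, g2, g3]))
  all_goals (
    rcases hx.step 4 with ⟨g4, e4⟩ | ⟨g4, e4⟩ <;> norm_num at g4 e4 <;> rw [e3] at g4 <;>
    (try simp only [e3, e2] at e4) <;> (try ring_nf at e4) <;> try (exfalso; linarith only [g0, g1, g2, g3, g4]))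
  all_goals (
    rcases hx.step 5 with ⟨g5, e5⟩ | ⟨g5, e5⟩ <;> norm_num at g5 e5 <;> rw [e4] at g5 <;>
    (try simp only [e4, e3] at e5) <;> (try ring_nf at e5) <;> try (exfalso; linarith only [g0, g1, g2, g3, g4, g5]))
  all_goals (
    rcases hx.step 6 with ⟨g6, e6⟩ | ⟨g6, e6⟩ <;> norm_num at g6 e6 <;> rw [e5] at g6 <;>
    (try simp only [e5, e4] at e6) <;> (try ring_nf at e6) <;> try (exfalso; linarith only [g0, g1, g2, g3, g4, g5, g6]))
  all_goals (
    rcases hx.step 7 with ⟨g7, e7⟩ | ⟨g7, e7⟩ <;> norm_num at g7 e7 <;> rw [e6] at g7 <;>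
    (try simp only [e6, e5] at e7) <;> (try ring_nf at e7) <;> try (exfalso; linarith only [g0, g1, g2, g3, g4, g5, g6, g7]))
  all_goals
    refine ⟨?_, show x 9 = x 1 from ?_⟩
    · first | exact e6 | linarith
    · first | exact e7 | linarith

lemma good_12 : PGood (-1) (-3) 1 12 := by
  intro x hx
  rcases hx.step 0 with ⟨g0, e0⟩ | ⟨g0, e0⟩ <;> norm_num at g0 e0
  all_goals (
    rcases hx.step 1 with ⟨g1, e1⟩ | ⟨g1, e1⟩ <;> norm_num at g1 e1 <;> rw [e0] at g1 <;>
    (try simp only [e0] at e1) <;> (try ring_nf at e1) <;> try (exfalso; linarith only [g0, g1]))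
  all_goals (
    rcases hx.step 2 with ⟨g2, e2⟩ | ⟨g2, e2⟩ <;> norm_num at g2 e2 <;> rw [e1] at g2 <;>
    (try simp only [e1, e0] at e2) <;> (try ring_nf at e2) <;> try (exfalso; linarith only [g0, g1, g2]))
  all_goals (
    rcases hx.step 3 with ⟨g3, e3⟩ | ⟨g3, e3⟩ <;> norm_num at g3 e3 <;> rw [e2] at g3 <;>
    (try simp only [e2, e1] at e3) <;> (try ring_nf at e3) <;> try (exfalso; linarith only [g0, g1, g2, g3]))
  all_goals (
    rcases hx.step 4 with ⟨g4, e4⟩ | ⟨g4, e4⟩ <;> norm_num at g4 e4 <;> rw [e3] at g4 <;>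
    (try simp only [e3, e2] at e4) <;> (try ring_nf at e4) <;> try (exfalso; linarith only [g0, g1, g2, g3, g4]))
  all_goals (
    rcases hx.step 5 with ⟨g5, e5⟩ | ⟨g5, e5⟩ <;> norm_num at g5 e5 <;> rw [e4] at g5 <;>
    (try simp only [e4, e3] at e5) <;> (try ring_nf at e5) <;> try (exfalso; linarith only [g0, g1, g2, g3, g4, g5]))
  all_goals (
    rcases hx.step 6 with ⟨g6, e6⟩ | ⟨g6, e6⟩ <;> norm_num at g6 e6 <;> rw [e5] at g6 <;>
    (try simp only [e5, e4] at e6) <;> (try ring_nf at e6) <;> try (exfalso; linarith only [g0, g1, g2, g3, g4, g5, g6]))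
  all_goals (
    rcases hx.step 7 with ⟨g7, e7⟩ | ⟨g7, e7⟩ <;> norm_num at g7 e7 <;> rw [e6] at g7 <;>
    (try simp only [e6, e5] at e7) <;> (try ring_nf at e7) <;> try (exfalso; linarith only [g0, g1, g2, g3, g4, g5, g6, g7]))
  all_goals (
    rcases hx.step 8 with ⟨g8, e8⟩ | ⟨g8, e8⟩ <;> norm_num at g8 e8 <;> rw [e7] at g8 <;>
    (try simp only [e7, e6] at e8) <;> (try ring_nf at e8) <;> try (exfalso; linarith only [g0, g1, g2, g3, g4, g5, g6, g7, g8]))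
  all_goals (
    rcases hx.step 9 with ⟨g9, e9⟩ | ⟨g9, e9⟩ <;> norm_num at g9 e9 <;> rw [e8] at g9 <;>
    (try simp only [e8, e7] at e9) <;> (try ring_nf at e9) <;> try (exfalso; linarith only [g0, g1, g2, g3, g4, g5, g6, g7, g8, g9]))
  all_goals (
    rcases hx.step 10 with ⟨g10, e10⟩ | ⟨g10, e10⟩ <;> norm_num at g10 e10 <;> rw [e9] at g10 <;>
    (try simp only [e9, e8] at e10) <;> (try ring_nf at e10) <;> try (exfalso; linarith only [g0, g1, g2, g3, g4, g5, g6, g7, g8, g9, g10]))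
  all_goals (
    rcases hx.step 11 with ⟨g11, e11⟩ | ⟨g11, e11⟩ <;> norm_num at g11 e11 <;> rw [e10] at g11 <;>
    (try simp only [e10, e9] at e11) <;> (try ring_nf at e11) <;> try (exfalso; linarith only [g0, g1, g2, g3, g4, g5, g6, g7, g8, g9, g10, g11]))
  all_goals
    refine ⟨?_, show x 13 = x 1 from ?_⟩
    · first | exact e10 | linarith
    · first | exact e11 | linarith

lemma good_neg : PGood 0 0 (-1) 2 := by
  intro x hx
  have h0 := hx 0
  have h1 := hx 1
  norm_num at h0 h1 ⊢
  grind

lemma classify_aux {p q : ℤ} {n : ℕ} (hn : 1 ≤ n) (h : PAll p q 1 n) (hpq : q ≤ p) :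
    ∃ k ∈ ({2, 3, 4, 5, 6, 7, 8, 9, 12} : Finset ℕ), PGood p q 1 k := by
  have hp : p < 2 := by by_contra hc; exact pos_two hn h (by omega)
  by_cases hp2 : p ≤ -2
  · exact (pos_neg_two hn h hp2 (by omega)).elim
  have : p = 1 ∨ p = 0 ∨ p = -1 := by omega
  rcases this with rfl | rfl | rfl
  · have hq : ¬ q ≤ -2 := pos_one hn h
    have : q = 1 ∨ q = 0 ∨ q = -1 := by omega
    rcases this with rfl | rfl | rfl
    · exact ⟨6, by decide, good_6⟩
    · exact ⟨5, by decide, good_5⟩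
    · exact ⟨9, by decide, good_9⟩
  · have hq : ¬ q ≤ -2 := pos_zero hn h
    have : q = 0 ∨ q = -1 := by omega
    rcases this with rfl | rfl
    · exact ⟨4, by decide, good_4⟩
    · exact ⟨7, by decide, good_7⟩
  · have hq : ¬ q ≤ -4 := pos_neg_one hn h
    have : q = -1 ∨ q = -2 ∨ q = -3 := by omega
    rcases this with rfl | rfl | rfl
    · exact ⟨3, by decide, good_3⟩
    · exact ⟨8, by decide, good_8⟩
    · exact ⟨12, by decide, good_12⟩

lemma classify {p q e : ℤ} {n : ℕ} (hn : 1 ≤ n) (he : e = 1 ∨ e = -1) (h : PAll p q e n) :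
    ∃ k ∈ ({2, 3, 4, 5, 6, 7, 8, 9, 12} : Finset ℕ), PGood p q e k := by
  rcases he with rfl | rfl
  · rcases le_total q p with hpq | hpq
    · exact classify_aux hn h hpq
    · obtain ⟨k, hk, hg⟩ := classify_aux hn h.swap hpq
      exact ⟨k, hk, hg.swap⟩
  · obtain ⟨rfl, rfl⟩ := neg_e_zero hn h
    exact ⟨2, by decide, good_neg⟩

lemma shear_zero {F : ℝ × ℝ → ℝ × ℝ} {t s : ℝ} {n : ℕ} (hn : 1 ≤ n) (hF : F^[n] = id)
    (h : ∀ y, F (t, y) = (t, y + s)) : s = 0 := by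
  have key : ∀ k : ℕ, F^[k] (t, 0) = (t, k * s) := by
    intro k
    induction k with
    | zero => simp
    | succ k ih => rw [Function.iterate_succ_apply', ih, h]; push_cast; congr 1; ring
  have := key n
  rw [hF] at this
  simp only [id, Prod.mk.injEq, true_and] at this
  have hn' : (n:ℝ) ≠ 0 := by positivity
  rcases mul_eq_zero.1 this.symm with h | h
  · exact (hn' h).elim
  · exact h

/-- the case `b = 0` -/
lemma case_b_zero {f : ℝ × ℝ → ℝ × ℝ} {a₁ a₂ c₁ c₂ d e : ℤ}
    (h1 : ∀ p : ℝ × ℝ, 0 ≤ p.1 → f p = (a₁ * p.1, c₁ * p.1 + d * p.2))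
    (h2 : ∀ p : ℝ × ℝ, p.1 ≤ 0 → f p = (a₂ * p.1, c₂ * p.1 + d * p.2))
    (he : e = 1 ∨ e = -1) (e1 : a₁ * d = e) (e2 : a₂ * d = e)
    {n : ℕ} (hn : 1 ≤ n) (hper : f^[n] = id) : f^[2] = id := by
  have hd : d = 1 ∨ d = -1 := by
    apply Int.isUnit_iff.1
    apply isUnit_of_mul_isUnit_right (x := a₁)
    rw [e1]; exact Int.isUnit_iff.2 he
  have haa : a₁ = a₂ := by rcases hd with rfl | rfl <;> omega
  subst haa
  have ha : a₁ = 1 ∨ a₁ = -1 := by rcases hd with rfl | rfl <;> omega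
  have hper2 : (f^[2])^[n] = id := by
    rw [← Function.iterate_mul, mul_comm, Function.iterate_mul, hper]; simp
  obtain ⟨s, s', hs, hs'⟩ : ∃ s s' : ℝ, (∀ x y : ℝ, 0 ≤ x → f^[2] (x, y) = (x, y + s * x)) ∧
      (∀ x y : ℝ, x ≤ 0 → f^[2] (x, y) = (x, y + s' * x)) := by
    rcases ha with rfl | rfl
    · refine ⟨c₁ + d * c₁, c₂ + d * c₂, ?_, ?_⟩
      · intro x y hx
        have : f^[2] (x, y) = f (f (x, y)) := rfl
        rw [this, h1 (x, y) hx, h1 _ (by simpa using hx)]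
        rcases hd with rfl | rfl <;> ext <;> simp <;> ring
      · intro x y hx
        have : f^[2] (x, y) = f (f (x, y)) := rfl
        rw [this, h2 (x, y) hx, h2 _ (by simpa using hx)]
        rcases hd with rfl | rfl <;> ext <;> simp <;> ring
    · refine ⟨-c₂ + d * c₁, -c₁ + d * c₂, ?_, ?_⟩
      · intro x y hx
        have : f^[2] (x, y) = f (f (x, y)) := rfl
        rw [this, h1 (x, y) hx, h2 _ (by simpa using hx)]
        rcases hd with rfl | rfl <;> ext <;> simp <;> ring
      · intro x y hx
        have : f^[2] (x, y) = f (f (x, y)) := rfl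
        rw [this, h2 (x, y) hx, h1 _ (by simpa using hx)]
        rcases hd with rfl | rfl <;> ext <;> simp <;> ring
  have z : s * 1 = 0 := shear_zero hn hper2 (fun y => hs 1 y (by norm_num))
  have z' : s' * (-1) = 0 := shear_zero hn hper2 (fun y => hs' (-1) y (by norm_num))
  have z1 : s = 0 := by linarith
  have z2 : s' = 0 := by linarith
  funext ⟨x, y⟩
  rcases le_total 0 x with hx | hx
  · rw [hs x y hx, z1]; simp
  · rw [hs' x y hx, z2]; simp

/-- both determinants agree and are units -/
lemma dets {f : ℝ × ℝ → ℝ × ℝ} {a₁ a₂ b c₁ c₂ d : ℤ}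
    (h1 : ∀ p : ℝ × ℝ, 0 ≤ p.1 → f p = (a₁ * p.1 + b * p.2, c₁ * p.1 + d * p.2))
    (h2 : ∀ p : ℝ × ℝ, p.1 ≤ 0 → f p = (a₂ * p.1 + b * p.2, c₂ * p.1 + d * p.2))
    {n : ℕ} (hn : 1 ≤ n) (hper : f^[n] = id) :
    ∃ e : ℤ, (e = 1 ∨ e = -1) ∧ a₁ * d - b * c₁ = e ∧ a₂ * d - b * c₂ = e := by
  have hint : ∀ u v : ℤ, ∃ u' v' : ℤ, f ((u:ℝ), (v:ℝ)) = ((u':ℝ), (v':ℝ)) := by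
    intro u v
    rcases le_total (0:ℝ) u with hu | hu
    · exact ⟨a₁ * u + b * v, c₁ * u + d * v, by rw [h1 _ hu]; push_cast; rfl⟩
    · exact ⟨a₂ * u + b * v, c₂ * u + d * v, by rw [h2 _ hu]; push_cast; rfl⟩
  have hintk : ∀ (k : ℕ) (u v : ℤ), ∃ u' v' : ℤ, f^[k] ((u:ℝ), (v:ℝ)) = ((u':ℝ), (v':ℝ)) := by
    intro k u v
    induction k with
    | zero => exact ⟨u, v, rfl⟩
    | succ k ih =>
      obtain ⟨u', v', h⟩ := ih
      rw [Function.iterate_succ_apply', h]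
      exact hint u' v'
  obtain ⟨m, rfl⟩ : ∃ m, n = m + 1 := ⟨n - 1, by omega⟩
  have hsurj : ∀ u v : ℤ, ∃ u' v' : ℤ, f ((u':ℝ), (v':ℝ)) = ((u:ℝ), (v:ℝ)) := by
    intro u v
    obtain ⟨u', v', h⟩ := hintk m u v
    exact ⟨u', v', by rw [← h, ← Function.iterate_succ_apply' f, hper]; rfl⟩
  have hinj : Function.Injective f := by
    intro p q hpq
    have : f^[m+1] p = f^[m+1] q := by rw [Function.iterate_succ_apply, Function.iterate_succ_apply, hpq]
    rw [hper] at this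
    exact this
  -- surjectivity on integer points, in integer form
  have hZ : ∀ u v : ℤ, ∃ s t : ℤ, (0 ≤ s ∧ a₁ * s + b * t = u ∧ c₁ * s + d * t = v) ∨
      (s ≤ 0 ∧ a₂ * s + b * t = u ∧ c₂ * s + d * t = v) := by
    intro u v
    obtain ⟨s, t, h⟩ := hsurj u v
    refine ⟨s, t, ?_⟩
    rcases le_total 0 s with hs | hs
    · left
      rw [h1 _ (Int.cast_nonneg hs)] at h
      simp only [Prod.mk.injEq] at h
      exact ⟨hs, by exact_mod_cast h.1, by exact_mod_cast h.2⟩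
    · right
      rw [h2 _ (Int.cast_nonpos.2 hs)] at h
      simp only [Prod.mk.injEq] at h
      exact ⟨hs, by exact_mod_cast h.1, by exact_mod_cast h.2⟩
  have hcop : IsCoprime b d := by
    rw [Int.isCoprime_iff_gcd_eq_one]
    obtain ⟨b', hb'⟩ := Int.gcd_dvd_left (a := b) (b := d)
    obtain ⟨d', hd'⟩ := Int.gcd_dvd_right (a := b) (b := d)
    set g := Int.gcd b d with hg
    obtain ⟨s, t, h⟩ := hsurj b' d'
    have hgr : (0:ℝ) ≤ g := by positivity
    have hbr : (b:ℝ) = g * b' := by exact_mod_cast hb'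
    have hdr : (d:ℝ) = g * d' := by exact_mod_cast hd'
    have e1 : f ((g:ℝ) * s, (g:ℝ) * t) = f (0, 1) := by
      rw [h1 (0, 1) le_rfl]
      rcases le_total (0:ℝ) s with hs | hs
      · rw [h1 _ hs] at h
        rw [h1 _ (mul_nonneg hgr hs)]
        simp only [Prod.mk.injEq] at h ⊢
        constructor
        · linear_combination (g:ℝ) * h.1 - hbr
        · linear_combination (g:ℝ) * h.2 - hdr
      · rw [h2 _ hs] at h
        rw [h2 _ (mul_nonpos_of_nonneg_of_nonpos hgr hs)]
        simp only [Prod.mk.injEq] at h ⊢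
        constructor
        · linear_combination (g:ℝ) * h.1 - hbr
        · linear_combination (g:ℝ) * h.2 - hdr
    have e2 := hinj e1
    simp only [Prod.mk.injEq] at e2
    have e3 : (g:ℤ) * t = 1 := by exact_mod_cast e2.2
    have : (g:ℤ) ∣ 1 := ⟨t, e3.symm⟩
    have := Int.natCast_dvd_natCast.1 (by simpa using this : (g:ℤ) ∣ ((1:ℕ):ℤ))
    exact Nat.dvd_one.1 this
  obtain ⟨r, w, hrw⟩ := hcop
  obtain ⟨s, t, hst⟩ := hZ w (-r)
  obtain ⟨s', t', hst'⟩ := hZ (-w) r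
  have P : ((a₁ * d - b * c₁ = 1) ∨ (a₂ * d - b * c₂ = -1)) := by
    rcases hst with ⟨hs, k1, k2⟩ | ⟨hs, k1, k2⟩
    · left
      have : (a₁ * d - b * c₁) * s = 1 := by linear_combination d * k1 - b * k2 + hrw
      rcases Int.mul_eq_one_iff_eq_one_or_neg_one.1 this with h | h <;> omega
    · right
      have : (a₂ * d - b * c₂) * s = 1 := by linear_combination d * k1 - b * k2 + hrw
      rcases Int.mul_eq_one_iff_eq_one_or_neg_one.1 this with h | h <;> omega
  have Q : ((a₁ * d - b * c₁ = -1) ∨ (a₂ * d - b * c₂ = 1)) := by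
    rcases hst' with ⟨hs, k1, k2⟩ | ⟨hs, k1, k2⟩
    · left
      have : (a₁ * d - b * c₁) * (-s') = 1 := by linear_combination -d * k1 + b * k2 + hrw
      rcases Int.mul_eq_one_iff_eq_one_or_neg_one.1 this with h | h <;> omega
    · right
      have : (a₂ * d - b * c₂) * (-s') = 1 := by linear_combination -d * k1 + b * k2 + hrw
      rcases Int.mul_eq_one_iff_eq_one_or_neg_one.1 this with h | h <;> omega
  rcases P with P | P <;> rcases Q with Q | Q
  · omega
  · exact ⟨1, Or.inl rfl, P, Q⟩
  · exact ⟨-1, Or.inr rfl, Q, P⟩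
  · omega

lemma case_b_ne {f : ℝ × ℝ → ℝ × ℝ} {a₁ a₂ b c₁ c₂ d e : ℤ}
    (h1 : ∀ p : ℝ × ℝ, 0 ≤ p.1 → f p = (a₁ * p.1 + b * p.2, c₁ * p.1 + d * p.2))
    (h2 : ∀ p : ℝ × ℝ, p.1 ≤ 0 → f p = (a₂ * p.1 + b * p.2, c₂ * p.1 + d * p.2))
    (hb : b ≠ 0)
    (he : e = 1 ∨ e = -1) (e1 : a₁ * d - b * c₁ = e) (e2 : a₂ * d - b * c₂ = e)
    {n : ℕ} (hn : 1 ≤ n) (hper : f^[n] = id) :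
    ∃ k ∈ ({2, 3, 4, 5, 6, 7, 8, 9, 12} : Finset ℕ), f^[k] = id := by
  have hb' : (b:ℝ) ≠ 0 := by exact_mod_cast hb
  have e1' : (a₁:ℝ) * d - b * c₁ = e := by exact_mod_cast e1
  have e2' : (a₂:ℝ) * d - b * c₂ = e := by exact_mod_cast e2
  have hloc : ∀ p : ℝ × ℝ,
      b * (f p).2 = d * (f p).1 - e * p.1 := by
    intro p
    rcases le_total 0 p.1 with hp | hp
    · rw [h1 _ hp]; dsimp only; linear_combination (-p.1) * e1'
    · rw [h2 _ hp]; dsimp only; linear_combination (-p.1) * e2'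
  have horb : ∀ P, PRec (a₁ + d) (a₂ + d) e (fun i => (f^[i] P).1) := by
    intro P i
    simp only [Function.iterate_succ_apply']
    generalize f^[i] P = p
    have := hloc p
    constructor
    · intro h; rw [h1 _ h]; push_cast; linear_combination this
    · intro h; rw [h2 _ h]; push_cast; linear_combination this
  have hrep : ∀ u v : ℝ, ∃ P : ℝ × ℝ, P.1 = u ∧ (f P).1 = v := by
    intro u v
    rcases le_total 0 u with hu | hu
    · refine ⟨(u, (v - a₁ * u) / b), rfl, ?_⟩
      rw [h1 _ hu]; dsimp only; field_simp; ring
    · refine ⟨(u, (v - a₂ * u) / b), rfl, ?_⟩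
      rw [h2 _ hu]; dsimp only; field_simp; ring
  have hdet : ∀ P Q : ℝ × ℝ, P.1 = Q.1 → (f P).1 = (f Q).1 → P = Q := by
    intro P Q h h'
    refine Prod.ext h ?_
    rcases le_total 0 P.1 with hp | hp
    · rw [h1 _ hp, h1 _ (h ▸ hp)] at h'
      apply mul_left_cancel₀ hb'
      simp only [h] at h'; linarith
    · rw [h2 _ hp, h2 _ (h ▸ hp)] at h'
      apply mul_left_cancel₀ hb'
      simp only [h] at h'; linarith
  have huniq : ∀ x y, PRec (a₁ + d) (a₂ + d) e x → PRec (a₁ + d) (a₂ + d) e y →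
      x 0 = y 0 → x 1 = y 1 → ∀ i, x i = y i ∧ x (i+1) = y (i+1) := by
    intro x y hx hy g0 g1 i
    induction i with
    | zero => exact ⟨g0, g1⟩
    | succ i ih =>
      refine ⟨ih.2, ?_⟩
      rcases le_total 0 (x (i+1)) with h | h
      · rw [(hx i).1 h, (hy i).1 (ih.2 ▸ h), ih.1, ih.2]
      · rw [(hx i).2 h, (hy i).2 (ih.2 ▸ h), ih.1, ih.2]
  have hall : PAll (a₁ + d) (a₂ + d) e n := by
    intro x hx i
    obtain ⟨P, k0, k1⟩ := hrep (x 0) (x 1)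
    have hu := huniq x _ hx (horb P) k0.symm k1.symm
    rw [(hu _).1, (hu _).1]
    simp only [Function.iterate_add_apply, hper, id]
  obtain ⟨k, hk, hg⟩ := classify hn he hall
  refine ⟨k, hk, ?_⟩
  funext P
  have := hg _ (horb P)
  apply hdet
  · exact this.1
  · have h3 := this.2
    simp only [Function.iterate_succ_apply'] at h3
    exact h3

lemma sInf_of_iter {f : ℝ × ℝ → ℝ × ℝ} {k : ℕ}
    (hk : k ∈ ({2, 3, 4, 5, 6, 7, 8, 9, 12} : Finset ℕ)) (h : f^[k] = id) :
    sInf {k : ℕ | 1 ≤ k ∧ f^[k] = id} ∈ ({1, 2, 3, 4, 5, 6, 7, 8, 9, 12} : Set ℕ) := by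
  have hk1 : 1 ≤ k ∧ k ≤ 12 := by
    simp only [Finset.mem_insert, Finset.mem_singleton] at hk; omega
  have hmem : sInf {k : ℕ | 1 ≤ k ∧ f^[k] = id} ∈ {k : ℕ | 1 ≤ k ∧ f^[k] = id} :=
    Nat.sInf_mem ⟨k, hk1.1, h⟩
  have hmin : ∀ j, 1 ≤ j → f^[j] = id → sInf {k : ℕ | 1 ≤ k ∧ f^[k] = id} ≤ j :=
    fun j h1 h2 => Nat.sInf_le ⟨h1, h2⟩
  generalize sInf {k : ℕ | 1 ≤ k ∧ f^[k] = id} = m at *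
  obtain ⟨m1, m2⟩ := hmem
  have hr : f^[k % m] = id := by
    have e : f^[k % m + m * (k / m)] = id := by rw [Nat.mod_add_div]; exact h
    rw [Function.iterate_add, Function.iterate_mul, m2] at e
    simpa using e
  have hdiv : k % m = 0 := by
    by_contra hc
    have := hmin _ (by omega) hr
    have := Nat.mod_lt k (by omega : m > 0)
    omega
  have hle := hmin k hk1.1 h
  simp only [Finset.mem_insert, Finset.mem_singleton] at hk
  simp only [Set.mem_insert_iff, Set.mem_singleton_iff]
  have : m ≤ 12 := by omega
  interval_cases m <;> omega

theorem halfplane_piecewise_periods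
    (f : ℝ × ℝ → ℝ × ℝ) (hf : Continuous f)
    (A₁ A₂ : Matrix (Fin 2) (Fin 2) ℤ)
    (h1 : ∀ p : ℝ × ℝ, 0 ≤ p.1 →
      f p = ((A₁ 0 0 : ℝ) * p.1 + (A₁ 0 1 : ℝ) * p.2,
             (A₁ 1 0 : ℝ) * p.1 + (A₁ 1 1 : ℝ) * p.2))
    (h2 : ∀ p : ℝ × ℝ, p.1 < 0 →
      f p = ((A₂ 0 0 : ℝ) * p.1 + (A₂ 0 1 : ℝ) * p.2,
             (A₂ 1 0 : ℝ) * p.1 + (A₂ 1 1 : ℝ) * p.2))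
    (n : ℕ) (hn : 1 ≤ n) (hper : f^[n] = id) :
    sInf {k : ℕ | 1 ≤ k ∧ f^[k] = id} ∈
      ({1, 2, 3, 4, 5, 6, 7, 8, 9, 12} : Set ℕ) := by
  have hlim : f (0, 1) = ((A₂ 0 1 : ℝ), (A₂ 1 1 : ℝ)) := by
    have t1 : Filter.Tendsto (fun t : ℝ => f (t, 1)) (nhdsWithin 0 (Set.Iio 0))
        (nhds (f (0, 1))) := by
      have : Continuous (fun t : ℝ => f (t, 1)) := by fun_prop
      exact (this.tendsto 0).mono_left nhdsWithin_le_nhds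
    have t2 : Filter.Tendsto (fun t : ℝ => (((A₂ 0 0 : ℝ) * t + (A₂ 0 1 : ℝ) * 1,
        (A₂ 1 0 : ℝ) * t + (A₂ 1 1 : ℝ) * 1) : ℝ × ℝ)) (nhdsWithin 0 (Set.Iio 0))
        (nhds ((A₂ 0 1 : ℝ), (A₂ 1 1 : ℝ))) := by
      have hc : Continuous (fun t : ℝ => (((A₂ 0 0 : ℝ) * t + (A₂ 0 1 : ℝ) * 1,
        (A₂ 1 0 : ℝ) * t + (A₂ 1 1 : ℝ) * 1) : ℝ × ℝ)) := by fun_prop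
      have := (hc.tendsto 0).mono_left (nhdsWithin_le_nhds (s := Set.Iio 0))
      simpa using this
    refine tendsto_nhds_unique (t1.congr' ?_) t2
    filter_upwards [self_mem_nhdsWithin] with t ht
    exact h2 (t, 1) ht
  rw [h1 (0, 1) le_rfl] at hlim
  simp only [mul_zero, zero_add, mul_one, Prod.mk.injEq, Int.cast_inj] at hlim
  obtain ⟨hb, hd⟩ := hlim
  have h2' : ∀ p : ℝ × ℝ, p.1 ≤ 0 →
      f p = ((A₂ 0 0 : ℝ) * p.1 + (A₁ 0 1 : ℝ) * p.2,
             (A₂ 1 0 : ℝ) * p.1 + (A₁ 1 1 : ℝ) * p.2) := by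
    intro p hp
    rcases hp.lt_or_eq with hp | hp
    · rw [h2 p hp, hb, hd]
    · rw [h1 p hp.ge, hp]; simp
  obtain ⟨e, he, d1, d2⟩ := dets h1 h2' hn hper
  by_cases hb0 : A₁ 0 1 = 0
  · rw [hb0] at h1 h2' d1 d2
    simp only [Int.cast_zero, zero_mul, add_zero, sub_zero] at h1 h2' d1 d2
    exact sInf_of_iter (k := 2) (by decide) (case_b_zero h1 h2' he d1 d2 hn hper)
  · obtain ⟨k, hk, hid⟩ := case_b_ne h1 h2' hb0 he d1 d2 hn hper
    exact sInf_of_iter hk hid
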